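/- For Y ~ N_k(μ, I_k) with k ≥ 3, the James–Stein estimator μ̃(Y) = (1 - (k-2)/‖Y‖²) Y satisfies E_μ‖μ̃ - μ‖² = k - (k-2)² E_μ[1/‖Y‖²], which is strictly less than k for every μ ∈ ℝ^k. -/

import Mathlib

open MeasureTheory

/-- The Gaussian density with mean `μ` and identity covariance on `ℝ^k`. -/
noncomputable def gaussDensity (k : ℕ) (μ y : EuclideanSpace ℝ (Fin k)) : ℝ :=
  (2 * Real.pi) ^ (-(k : ℝ) / 2) * Real.exp (-‖y - μ‖ ^ 2 / 2)

/-- The James–Stein estimator `μ̃(y) = (1 - (k-2)/‖y‖²) y`. -/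
noncomputable def jamesStein (k : ℕ) (y : EuclideanSpace ℝ (Fin k)) :
    EuclideanSpace ℝ (Fin k) :=
  (1 - ((k : ℝ) - 2) / ‖y‖ ^ 2) • y

open Set Filter Topology

section JamesStein

variable {k : ℕ}

lemma gaussDensity_pos (μ y : EuclideanSpace ℝ (Fin k)) : 0 < gaussDensity k μ y := by
  unfold gaussDensity
  positivity

lemma continuous_gaussDensity (μ : EuclideanSpace ℝ (Fin k)) : Continuous (gaussDensity k μ) := by
  unfold gaussDensity
  fun_prop

lemma integral_gaussDensity (μ : EuclideanSpace ℝ (Fin k)) : ∫ y, gaussDensity k μ y = 1 := by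
  unfold gaussDensity
  rw [integral_const_mul,
    integral_sub_right_eq_self (fun y : EuclideanSpace ℝ (Fin k) => Real.exp (-‖y‖ ^ 2 / 2)) μ]
  have h := GaussianFourier.integral_rexp_neg_mul_sq_norm (V := EuclideanSpace ℝ (Fin k))
    (b := 1 / 2) (by norm_num)
  have e : (fun y : EuclideanSpace ℝ (Fin k) => Real.exp (-‖y‖ ^ 2 / 2)) =
      fun y => Real.exp (-(1 / 2) * ‖y‖ ^ 2) := by
    ext y; congr 1; ring
  rw [e, h, finrank_euclideanSpace_fin, show Real.pi / (1 / 2) = 2 * Real.pi by ring,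
    ← Real.rpow_add (by positivity), show -(k : ℝ) / 2 + k / 2 = 0 by ring, Real.rpow_zero]

lemma integrable_rpow_norm_mul_exp_neg_mul_sq [NeZero k] {b s : ℝ} (hb : 0 < b)
    (hs : -(k : ℝ) < s) :
    Integrable (fun y : EuclideanSpace ℝ (Fin k) => ‖y‖ ^ s * Real.exp (-b * ‖y‖ ^ 2)) := by
  rw [integrable_fun_norm_addHaar volume (f := fun r : ℝ => r ^ s * Real.exp (-b * r ^ 2)),
    finrank_euclideanSpace_fin]
  have h := integrableOn_rpow_mul_exp_neg_mul_sq hb (s := (k : ℝ) - 1 + s) (by linarith)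
  refine (integrableOn_congr_fun (fun r hr => ?_) measurableSet_Ioi).mp h
  have hr : 0 < r := hr
  have hk : 1 ≤ k := NeZero.one_le
  rw [Real.rpow_add hr, smul_eq_mul, ← Real.rpow_natCast r (k - 1), Nat.cast_sub hk, Nat.cast_one,
    mul_assoc]

lemma integrable_gaussDensity (μ : EuclideanSpace ℝ (Fin k)) : Integrable (gaussDensity k μ) :=
  Integrable.of_integral_ne_zero (by rw [integral_gaussDensity]; exact one_ne_zero)

lemma integrable_sq_norm_sub_mul_gaussDensity [NeZero k] (μ : EuclideanSpace ℝ (Fin k)) :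
    Integrable (fun y => ‖y - μ‖ ^ 2 * gaussDensity k μ y) := by
  have h := ((integrable_rpow_norm_mul_exp_neg_mul_sq (k := k) (b := 1 / 2) (s := 2)
    (by norm_num) (by have : (0 : ℝ) ≤ k := k.cast_nonneg; linarith)).comp_sub_right μ).const_mul
    ((2 * Real.pi) ^ (-(k : ℝ) / 2))
  refine h.congr (ae_of_all _ fun y => ?_)
  simp only [gaussDensity, Real.rpow_two]
  rw [show -‖y - μ‖ ^ 2 / 2 = -(1 / 2) * ‖y - μ‖ ^ 2 by ring]
  ring

lemma integrable_inv_sq_norm_mul_gaussDensity (hk : 3 ≤ k) (μ : EuclideanSpace ℝ (Fin k)) :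
    Integrable (fun y => 1 / ‖y‖ ^ 2 * gaussDensity k μ y) := by
  have : NeZero k := ⟨by omega⟩
  have h := (integrable_rpow_norm_mul_exp_neg_mul_sq (k := k) (b := 1 / 4) (s := -2)
    (by norm_num) (by have : (3 : ℝ) ≤ k := by exact_mod_cast hk
                      linarith)).const_mul
    ((2 * Real.pi) ^ (-(k : ℝ) / 2) * Real.exp (‖μ‖ ^ 2 / 2))
  refine h.mono' ?_ (ae_of_all _ fun y => ?_)
  · have := (continuous_gaussDensity μ).measurable
    exact (by fun_prop : Measurable _).aestronglyMeasurable
  · rw [Real.norm_of_nonneg (mul_nonneg (by positivity) (gaussDensity_pos μ y).le),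
      Real.rpow_neg (norm_nonneg y), Real.rpow_two, gaussDensity]
    have hexp : Real.exp (-‖y - μ‖ ^ 2 / 2) ≤
        Real.exp (‖μ‖ ^ 2 / 2) * Real.exp (-(1 / 4) * ‖y‖ ^ 2) := by
      rw [← Real.exp_add, Real.exp_le_exp]
      have h1 : ‖y‖ ≤ ‖y - μ‖ + ‖μ‖ := by simpa using norm_add_le (y - μ) μ
      nlinarith [norm_nonneg y, sq_nonneg (‖y - μ‖ - ‖μ‖),
        mul_self_le_mul_self (norm_nonneg y) h1]
    calc 1 / ‖y‖ ^ 2 * ((2 * Real.pi) ^ (-(k : ℝ) / 2) * Real.exp (-‖y - μ‖ ^ 2 / 2))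
        ≤ 1 / ‖y‖ ^ 2 * ((2 * Real.pi) ^ (-(k : ℝ) / 2) *
          (Real.exp (‖μ‖ ^ 2 / 2) * Real.exp (-(1 / 4) * ‖y‖ ^ 2))) := by gcongr
      _ = _ := by ring

/-- Away from the origin, growth at most that of `1/‖y‖² + 1 + ‖y - μ‖²` is enough for
integrability against the Gaussian density. -/
lemma integrable_mul_gaussDensity_of_le (hk : 3 ≤ k) (μ : EuclideanSpace ℝ (Fin k))
    {f : EuclideanSpace ℝ (Fin k) → ℝ} (hf : Measurable f) (A B C : ℝ)
    (hbound : ∀ y ≠ 0, |f y| ≤ A * (1 / ‖y‖ ^ 2) + B + C * ‖y - μ‖ ^ 2) :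
    Integrable (fun y => f y * gaussDensity k μ y) := by
  have : NeZero k := ⟨by omega⟩
  have h := (((integrable_inv_sq_norm_mul_gaussDensity hk μ).const_mul A).add
    ((integrable_gaussDensity μ).const_mul B)).add
    ((integrable_sq_norm_sub_mul_gaussDensity μ).const_mul C)
  have hm := (continuous_gaussDensity μ).measurable
  refine h.mono' (hf.mul hm).aestronglyMeasurable ?_
  filter_upwards [Measure.ae_ne volume (0 : EuclideanSpace ℝ (Fin k))] with y hy
  have := mul_le_mul_of_nonneg_right (hbound y hy) (gaussDensity_pos μ y).le
  rw [norm_mul, Real.norm_eq_abs, Real.norm_of_nonneg (gaussDensity_pos μ y).le]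
  simp only [Pi.add_apply]
  linarith

lemma hasLineDerivAt_gaussDensity (μ y : EuclideanSpace ℝ (Fin k)) (i : Fin k) :
    HasLineDerivAt ℝ (gaussDensity k μ) (-((y i - μ i) * gaussDensity k μ y)) y
      (EuclideanSpace.single i 1) := by
  have h1 : HasDerivAt (fun t : ℝ => y + t • EuclideanSpace.single i (1 : ℝ) - μ)
      (EuclideanSpace.single i (1 : ℝ)) 0 := by
    simpa using (((hasDerivAt_id (0 : ℝ)).smul_const
      (EuclideanSpace.single i (1 : ℝ))).const_add y).sub_const μ
  have h2 := ((h1.norm_sq.neg.div_const 2).exp.const_mul ((2 * Real.pi) ^ (-(k : ℝ) / 2)))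
  refine h2.congr_deriv ?_
  simp [gaussDensity, EuclideanSpace.inner_single_right]
  ring

/-- **Stein's identity** in one coordinate. -/
lemma integral_mul_coord_sub_mul_gaussDensity (μ : EuclideanSpace ℝ (Fin k)) (i : Fin k)
    {g g' : EuclideanSpace ℝ (Fin k) → ℝ}
    (hg : ∀ y, HasLineDerivAt ℝ g (g' y) y (EuclideanSpace.single i 1))
    (hig : Integrable fun y => g y * gaussDensity k μ y)
    (hig' : Integrable fun y => g' y * gaussDensity k μ y)
    (hgi : Integrable fun y => g y * (y i - μ i) * gaussDensity k μ y) :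
    ∫ y, g y * (y i - μ i) * gaussDensity k μ y = ∫ y, g' y * gaussDensity k μ y := by
  have h := integral_bilinear_hasLineDerivAt_right_eq_neg_left_of_integrable
    (μ := (volume : Measure (EuclideanSpace ℝ (Fin k)))) (B := ContinuousLinearMap.mul ℝ ℝ)
    (f := g) (f' := g') (g := gaussDensity k μ)
    (g' := fun y => -((y i - μ i) * gaussDensity k μ y)) (v := EuclideanSpace.single i 1)
    (by simpa using hig') (by simpa [mul_assoc] using hgi) (by simpa using hig)
    (fun y _ => hg y) (fun y _ => hasLineDerivAt_gaussDensity μ y i)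
  simpa [mul_assoc, integral_neg] using h

lemma abs_coord_le_norm (y : EuclideanSpace ℝ (Fin k)) (i : Fin k) : |y i| ≤ ‖y‖ := by
  simpa using PiLp.norm_apply_le y i

lemma integral_sq_norm_sub_mul_gaussDensity (hk : 3 ≤ k) (μ : EuclideanSpace ℝ (Fin k)) :
    ∫ y, ‖y - μ‖ ^ 2 * gaussDensity k μ y = k := by
  have hint : ∀ i : Fin k, Integrable
      fun y => (y i - μ i) * (y i - μ i) * gaussDensity k μ y := fun i => by
    refine integrable_mul_gaussDensity_of_le hk μ (by fun_prop) 0 0 1 fun y _ => ?_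
    have := abs_coord_le_norm (y - μ) i
    simp only [PiLp.sub_apply] at this
    rw [abs_mul]
    nlinarith [abs_nonneg (y i - μ i)]
  have key : ∀ i : Fin k, ∫ y, (y i - μ i) * (y i - μ i) * gaussDensity k μ y = 1 := fun i => by
    refine (integral_mul_coord_sub_mul_gaussDensity μ i (g := fun y => y i - μ i)
      (g' := fun _ => 1) (fun y => ?_) ?_ (by simpa using integrable_gaussDensity μ)
      (hint i)).trans (by simpa using integral_gaussDensity μ)
    · have : HasDerivAt (fun t : ℝ => y i + t * 1 - μ i) 1 0 := by
        simpa using (((hasDerivAt_id (0 : ℝ)).mul_const 1).const_add (y i)).sub_const (μ i)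
      simpa [HasLineDerivAt] using this
    · refine integrable_mul_gaussDensity_of_le hk μ (by fun_prop) 0 1 1 fun y _ => ?_
      have := abs_coord_le_norm (y - μ) i
      simp only [PiLp.sub_apply] at this
      nlinarith [sq_nonneg (‖y - μ‖ - 1)]
  have e : ∀ y : EuclideanSpace ℝ (Fin k), ‖y - μ‖ ^ 2 * gaussDensity k μ y =
      ∑ i, (y i - μ i) * (y i - μ i) * gaussDensity k μ y := fun y => by
    rw [EuclideanSpace.real_norm_sq_eq, Finset.sum_mul]
    simp [sq]
  simp_rw [e]
  rw [integral_finsetSum _ fun i _ => hint i]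
  simp [key]

lemma abs_div_sq_norm_add_le (μ : EuclideanSpace ℝ (Fin k)) {y : EuclideanSpace ℝ (Fin k)}
    (hy : y ≠ 0) {a ε : ℝ} (hε : 0 ≤ ε) (ha : |a| ≤ ‖y‖ * ‖y - μ‖) :
    |a / (‖y‖ ^ 2 + ε)| ≤ 1 / ‖y‖ ^ 2 + ‖y - μ‖ ^ 2 := by
  have hy' : 0 < ‖y‖ := norm_pos_iff.mpr hy
  have hd : 0 < ‖y‖ ^ 2 + ε := by positivity
  rw [abs_div, abs_of_pos hd]
  calc |a| / (‖y‖ ^ 2 + ε) ≤ ‖y‖ * ‖y - μ‖ / ‖y‖ ^ 2 := by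
        gcongr
        linarith
    _ = (1 / ‖y‖) * ‖y - μ‖ := by field_simp
    _ ≤ (1 / ‖y‖) ^ 2 + ‖y - μ‖ ^ 2 := by
        nlinarith [sq_nonneg (1 / ‖y‖ - ‖y - μ‖), sq_nonneg (1 / ‖y‖), sq_nonneg ‖y - μ‖]
    _ = _ := by rw [one_div_pow]

lemma abs_div_sub_div_sq_le {y : EuclideanSpace ℝ (Fin k)} (hy : y ≠ 0) {a b ε : ℝ}
    (hε : 0 ≤ ε) (ha : 0 ≤ a) (hb : 0 ≤ b) (hby : b ≤ ‖y‖ ^ 2) :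
    |a / (‖y‖ ^ 2 + ε) - 2 * b / (‖y‖ ^ 2 + ε) ^ 2| ≤ (a + 2) * (1 / ‖y‖ ^ 2) := by
  have hy' : 0 < ‖y‖ := norm_pos_iff.mpr hy
  have hd : 0 < ‖y‖ ^ 2 + ε := by positivity
  have h1 : a / (‖y‖ ^ 2 + ε) ≤ a / ‖y‖ ^ 2 := by
    gcongr
    linarith
  have h2 : 2 * b / (‖y‖ ^ 2 + ε) ^ 2 ≤ 2 / ‖y‖ ^ 2 := by
    calc 2 * b / (‖y‖ ^ 2 + ε) ^ 2 ≤ 2 * ‖y‖ ^ 2 / (‖y‖ ^ 2) ^ 2 := by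
          gcongr
          linarith
      _ = 2 / ‖y‖ ^ 2 := by field_simp
  have h3 : 0 ≤ a / (‖y‖ ^ 2 + ε) := by positivity
  have h4 : 0 ≤ 2 * b / (‖y‖ ^ 2 + ε) ^ 2 := by positivity
  have h5 : (a + 2) * (1 / ‖y‖ ^ 2) = a / ‖y‖ ^ 2 + 2 / ‖y‖ ^ 2 := by ring
  rw [h5, abs_le]
  constructor <;> linarith

/-- Stein's identity for the regularized field `y ↦ y / (‖y‖² + ε)`. -/
lemma integral_inner_div_add_mul_gaussDensity (hk : 3 ≤ k) (μ : EuclideanSpace ℝ (Fin k))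
    {ε : ℝ} (hε : 0 < ε) :
    ∫ y, inner ℝ y (y - μ) / (‖y‖ ^ 2 + ε) * gaussDensity k μ y =
      ∫ y, (k / (‖y‖ ^ 2 + ε) - 2 * ‖y‖ ^ 2 / (‖y‖ ^ 2 + ε) ^ 2) * gaussDensity k μ y := by
  have hd : ∀ y : EuclideanSpace ℝ (Fin k), ‖y‖ ^ 2 + ε ≠ 0 := fun y => by positivity
  have hl : ∀ i : Fin k, Integrable
      fun y => y i / (‖y‖ ^ 2 + ε) * (y i - μ i) * gaussDensity k μ y := fun i => by
    refine integrable_mul_gaussDensity_of_le hk μ (by fun_prop) 1 0 1 fun y hy => ?_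
    have h := abs_div_sq_norm_add_le μ hy hε.le (a := y i * (y i - μ i)) (by
      rw [abs_mul]
      exact mul_le_mul (abs_coord_le_norm y i) (abs_coord_le_norm (y - μ) i) (abs_nonneg _)
        (norm_nonneg _))
    rw [div_mul_eq_mul_div]
    linarith
  have hr : ∀ i : Fin k, Integrable fun y => (1 / (‖y‖ ^ 2 + ε) -
      2 * y i ^ 2 / (‖y‖ ^ 2 + ε) ^ 2) * gaussDensity k μ y := fun i => by
    refine integrable_mul_gaussDensity_of_le hk μ (by fun_prop) 3 0 0 fun y hy => ?_
    have h := abs_div_sub_div_sq_le hy hε.le zero_le_one (sq_nonneg (y i))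
      (sq_le_sq.mpr (by simpa using abs_coord_le_norm y i))
    linarith
  have key : ∀ i : Fin k, ∫ y, y i / (‖y‖ ^ 2 + ε) * (y i - μ i) * gaussDensity k μ y =
      ∫ y, (1 / (‖y‖ ^ 2 + ε) - 2 * y i ^ 2 / (‖y‖ ^ 2 + ε) ^ 2) * gaussDensity k μ y := by
    intro i
    refine integral_mul_coord_sub_mul_gaussDensity μ i (fun y => ?_) ?_ (hr i) (hl i)
    · have h1 : HasDerivAt (fun t : ℝ => y + t • EuclideanSpace.single i (1 : ℝ))
          (EuclideanSpace.single i (1 : ℝ)) 0 := by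
        simpa using ((hasDerivAt_id (0 : ℝ)).smul_const
          (EuclideanSpace.single i (1 : ℝ))).const_add y
      have h2 : HasDerivAt (fun t : ℝ => (y + t • EuclideanSpace.single i (1 : ℝ)) i) 1 0 := by
        have : HasDerivAt (fun t : ℝ => y i + t * 1) 1 0 := by
          simpa using ((hasDerivAt_id (0 : ℝ)).mul_const 1).const_add (y i)
        simpa using this
      refine (h2.div (h1.norm_sq.add_const ε) (by simpa using hd y)).congr_deriv ?_
      have := hd y
      simp [EuclideanSpace.inner_single_right]
      field_simp
    · refine integrable_mul_gaussDensity_of_le hk μ (by fun_prop) 1 1 0 fun y hy => ?_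
      have hy' : 0 < ‖y‖ := norm_pos_iff.mpr hy
      have hd' : 0 < ‖y‖ ^ 2 + ε := by positivity
      rw [abs_div, abs_of_pos hd']
      calc |y i| / (‖y‖ ^ 2 + ε) ≤ ‖y‖ / ‖y‖ ^ 2 := by
            gcongr
            · exact abs_coord_le_norm y i
            · linarith
        _ = 1 / ‖y‖ := by field_simp
        _ ≤ (1 / ‖y‖) ^ 2 + 1 := by nlinarith [sq_nonneg (1 / ‖y‖ - 1)]
        _ = _ := by rw [one_div_pow]; ring
  have el : ∀ y : EuclideanSpace ℝ (Fin k),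
      inner ℝ y (y - μ) / (‖y‖ ^ 2 + ε) * gaussDensity k μ y =
      ∑ i, y i / (‖y‖ ^ 2 + ε) * (y i - μ i) * gaussDensity k μ y := fun y => by
    rw [PiLp.inner_apply, Finset.sum_div, Finset.sum_mul]
    refine Finset.sum_congr rfl fun i _ => ?_
    simp only [PiLp.sub_apply, RCLike.inner_apply, conj_trivial]
    ring
  have er : ∀ y : EuclideanSpace ℝ (Fin k),
      (k / (‖y‖ ^ 2 + ε) - 2 * ‖y‖ ^ 2 / (‖y‖ ^ 2 + ε) ^ 2) * gaussDensity k μ y =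
      ∑ i, (1 / (‖y‖ ^ 2 + ε) - 2 * y i ^ 2 / (‖y‖ ^ 2 + ε) ^ 2) * gaussDensity k μ y :=
    fun y => by
    rw [← Finset.sum_mul, Finset.sum_sub_distrib, ← Finset.sum_div, ← Finset.sum_div, ← Finset.mul_sum,
      ← EuclideanSpace.real_norm_sq_eq]
    simp [div_eq_mul_inv]
  simp_rw [el, er]
  rw [integral_finsetSum _ fun i _ => hl i, integral_finsetSum _ fun i _ => hr i]
  exact Finset.sum_congr rfl fun i _ => key i

/-- Stein's identity for the singular field `y ↦ y / ‖y‖²`. -/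
lemma integral_inner_div_sq_norm_mul_gaussDensity (hk : 3 ≤ k)
    (μ : EuclideanSpace ℝ (Fin k)) :
    ∫ y, inner ℝ y (y - μ) / ‖y‖ ^ 2 * gaussDensity k μ y =
      (k - 2) * ∫ y, 1 / ‖y‖ ^ 2 * gaussDensity k μ y := by
  have : NeZero k := ⟨by omega⟩
  have hm := (continuous_gaussDensity μ).measurable
  have hi1 := integrable_inv_sq_norm_mul_gaussDensity hk μ
  have hi2 := integrable_sq_norm_sub_mul_gaussDensity μ
  have hε : Tendsto (fun n : ℕ => 1 / ((n : ℝ) + 1)) atTop (𝓝 0) :=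
    tendsto_one_div_add_atTop_nhds_zero_nat
  have hpos : ∀ n : ℕ, 0 < 1 / ((n : ℝ) + 1) := fun n => Nat.one_div_pos_of_nat
  have hl : Tendsto (fun n : ℕ => ∫ y, inner ℝ y (y - μ) / (‖y‖ ^ 2 + 1 / ((n : ℝ) + 1)) *
      gaussDensity k μ y) atTop (𝓝 (∫ y, inner ℝ y (y - μ) / ‖y‖ ^ 2 * gaussDensity k μ y)) := by
    refine tendsto_integral_of_dominated_convergence _
      (fun n => (by fun_prop : Measurable _).aestronglyMeasurable) (hi1.add hi2) (fun n => ?_) ?_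
    · filter_upwards [Measure.ae_ne volume (0 : EuclideanSpace ℝ (Fin k))] with y hy
      have h := abs_div_sq_norm_add_le μ hy (hpos n).le (abs_real_inner_le_norm y (y - μ))
      rw [norm_mul, Real.norm_eq_abs, Real.norm_of_nonneg (gaussDensity_pos μ y).le,
        Pi.add_apply, ← add_mul]
      exact mul_le_mul_of_nonneg_right h (gaussDensity_pos μ y).le
    · filter_upwards [Measure.ae_ne volume (0 : EuclideanSpace ℝ (Fin k))] with y hy
      have hd : Tendsto (fun n : ℕ => ‖y‖ ^ 2 + 1 / ((n : ℝ) + 1)) atTop (𝓝 (‖y‖ ^ 2)) := by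
        simpa using hε.const_add (‖y‖ ^ 2)
      exact (tendsto_const_nhds.div hd (by simpa using hy)).mul_const _
  have hr : Tendsto (fun n : ℕ => ∫ y, (k / (‖y‖ ^ 2 + 1 / ((n : ℝ) + 1)) -
      2 * ‖y‖ ^ 2 / (‖y‖ ^ 2 + 1 / ((n : ℝ) + 1)) ^ 2) * gaussDensity k μ y) atTop
      (𝓝 (∫ y, (k - 2) * (1 / ‖y‖ ^ 2 * gaussDensity k μ y))) := by
    refine tendsto_integral_of_dominated_convergence _
      (fun n => (by fun_prop : Measurable _).aestronglyMeasurable)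
      (hi1.const_mul ((k : ℝ) + 2)) (fun n => ?_) ?_
    · filter_upwards [Measure.ae_ne volume (0 : EuclideanSpace ℝ (Fin k))] with y hy
      have h := abs_div_sub_div_sq_le hy (hpos n).le (Nat.cast_nonneg k) (sq_nonneg ‖y‖) le_rfl
      rw [norm_mul, Real.norm_eq_abs, Real.norm_of_nonneg (gaussDensity_pos μ y).le, ← mul_assoc]
      exact mul_le_mul_of_nonneg_right h (gaussDensity_pos μ y).le
    · filter_upwards [Measure.ae_ne volume (0 : EuclideanSpace ℝ (Fin k))] with y hy
      have hd : Tendsto (fun n : ℕ => ‖y‖ ^ 2 + 1 / ((n : ℝ) + 1)) atTop (𝓝 (‖y‖ ^ 2)) := by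
        simpa using hε.const_add (‖y‖ ^ 2)
      have hy' : ‖y‖ ≠ 0 := norm_ne_zero_iff.mpr hy
      have h := (((tendsto_const_nhds (x := (k : ℝ))).div hd (by positivity)).sub
        ((tendsto_const_nhds (x := 2 * ‖y‖ ^ 2)).div (hd.pow 2) (by positivity))).mul_const (gaussDensity k μ y)
      have e : ((k : ℝ) - 2) * (1 / ‖y‖ ^ 2 * gaussDensity k μ y) =
          (k / ‖y‖ ^ 2 - 2 * ‖y‖ ^ 2 / (‖y‖ ^ 2) ^ 2) * gaussDensity k μ y := by
        field_simp
      rw [e]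
      exact h
  rw [← integral_const_mul]
  refine tendsto_nhds_unique hl (hr.congr fun n => ?_)
  exact (integral_inner_div_add_mul_gaussDensity hk μ (hpos n)).symm

lemma integral_inv_sq_norm_mul_gaussDensity_pos (hk : 3 ≤ k) (μ : EuclideanSpace ℝ (Fin k)) :
    0 < ∫ y, 1 / ‖y‖ ^ 2 * gaussDensity k μ y := by
  have : NeZero k := ⟨by omega⟩
  rw [integral_pos_iff_support_of_nonneg
    (fun y => mul_nonneg (by positivity) (gaussDensity_pos μ y).le)
    (integrable_inv_sq_norm_mul_gaussDensity hk μ)]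
  have hs : Function.support (fun y => 1 / ‖y‖ ^ 2 * gaussDensity k μ y) = {0}ᶜ := by
    ext y
    simp [(gaussDensity_pos μ y).ne']
  rw [hs]
  exact isOpen_compl_singleton.measure_pos _ (Set.nonempty_compl_of_nontrivial 0)

lemma sq_norm_jamesStein_sub (μ : EuclideanSpace ℝ (Fin k)) {y : EuclideanSpace ℝ (Fin k)}
    (hy : y ≠ 0) :
    ‖jamesStein k y - μ‖ ^ 2 = ‖y - μ‖ ^ 2 -
      2 * ((k : ℝ) - 2) * (inner ℝ y (y - μ) / ‖y‖ ^ 2) + ((k : ℝ) - 2) ^ 2 * (1 / ‖y‖ ^ 2) := by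
  have hy' : ‖y‖ ≠ 0 := norm_ne_zero_iff.mpr hy
  have e : jamesStein k y - μ = (y - μ) - (((k : ℝ) - 2) / ‖y‖ ^ 2) • y := by
    rw [jamesStein, sub_smul, one_smul]
    abel
  rw [e, norm_sub_sq_real, inner_smul_right, real_inner_comm y (y - μ), norm_smul, mul_pow,
    Real.norm_eq_abs, sq_abs]
  field_simp

end JamesStein

/-- For `Y ~ N_k(μ, I_k)` with `k ≥ 3`, the James–Stein estimator satisfies
`E_μ‖μ̃ - μ‖² = k - (k-2)² E_μ[1/‖Y‖²] < k` for every `μ`. -/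
theorem james_stein_risk (k : ℕ) (hk : 3 ≤ k) (μ : EuclideanSpace ℝ (Fin k)) :
    (∫ y : EuclideanSpace ℝ (Fin k), ‖jamesStein k y - μ‖ ^ 2 * gaussDensity k μ y
        = (k : ℝ) - ((k : ℝ) - 2) ^ 2 *
            ∫ y : EuclideanSpace ℝ (Fin k), (1 / ‖y‖ ^ 2) * gaussDensity k μ y) ∧
      (∫ y : EuclideanSpace ℝ (Fin k), ‖jamesStein k y - μ‖ ^ 2 * gaussDensity k μ y
        < (k : ℝ)) := by
  have : NeZero k := ⟨by omega⟩
  have hi1 := integrable_inv_sq_norm_mul_gaussDensity hk μ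
  have hi2 := integrable_sq_norm_sub_mul_gaussDensity μ
  have hi3 : Integrable fun y => inner ℝ y (y - μ) / ‖y‖ ^ 2 * gaussDensity k μ y := by
    refine integrable_mul_gaussDensity_of_le hk μ (by fun_prop) 1 0 1 fun y hy => ?_
    simpa using abs_div_sq_norm_add_le μ hy le_rfl (abs_real_inner_le_norm y (y - μ))
  have risk : ∫ y : EuclideanSpace ℝ (Fin k), ‖jamesStein k y - μ‖ ^ 2 * gaussDensity k μ y
      = (k : ℝ) - ((k : ℝ) - 2) ^ 2 *
        ∫ y : EuclideanSpace ℝ (Fin k), (1 / ‖y‖ ^ 2) * gaussDensity k μ y := by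
    have e : ∀ᵐ y : EuclideanSpace ℝ (Fin k), ‖jamesStein k y - μ‖ ^ 2 * gaussDensity k μ y =
        ‖y - μ‖ ^ 2 * gaussDensity k μ y -
        2 * ((k : ℝ) - 2) * (inner ℝ y (y - μ) / ‖y‖ ^ 2 * gaussDensity k μ y) +
        ((k : ℝ) - 2) ^ 2 * (1 / ‖y‖ ^ 2 * gaussDensity k μ y) := by
      filter_upwards [Measure.ae_ne volume (0 : EuclideanSpace ℝ (Fin k))] with y hy
      rw [sq_norm_jamesStein_sub μ hy]
      ring
    have hi4 : Integrable fun y => ‖y - μ‖ ^ 2 * gaussDensity k μ y -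
        2 * ((k : ℝ) - 2) * (inner ℝ y (y - μ) / ‖y‖ ^ 2 * gaussDensity k μ y) :=
      hi2.sub (hi3.const_mul _)
    rw [integral_congr_ae e, integral_add hi4 (hi1.const_mul _),
      integral_sub hi2 (hi3.const_mul _), integral_const_mul, integral_const_mul,
      integral_inner_div_sq_norm_mul_gaussDensity hk μ,
      integral_sq_norm_sub_mul_gaussDensity hk μ]
    ring
  refine ⟨risk, ?_⟩
  rw [risk]
  have hk' : (3 : ℝ) ≤ k := by exact_mod_cast hk
  have hc : 0 < ((k : ℝ) - 2) ^ 2 := by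
    have : 0 < (k : ℝ) - 2 := by linarith
    positivity
  linarith [mul_pos hc (integral_inv_sq_norm_mul_gaussDensity_pos hk μ)]
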